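/- Let M be a pointed metric space and let Y be a real Banach space such that the pair (M, Y) has the Lip-BPB property for Lipschitz compact maps. Then for every σ-finite positive measure μ, the pair (M, L∞(μ, Y)) has the Lip-BPB property for Lipschitz compact maps, where L∞(μ, Y) is the Banach space of (equivalence classes of) essentially bounded strongly measurable Y-valued functions with the essential supremum norm. -/

import Mathlib

open Set Metric NNReal MeasureTheory

/-- A Lipschitz map vanishing at the base point `z`, i.e. an element of `Lip₀(M,Y)`. -/
def IsLip0 {M Y : Type*} [MetricSpace M] [NormedAddCommGroup Y]
    (z : M) (F : M → Y) : Prop :=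
  (∃ K : ℝ≥0, LipschitzWith K F) ∧ F z = 0

/-- The Lipschitz norm `‖F‖_L = sup {‖F p - F q‖ / d(p,q) : p ≠ q}`. -/
noncomputable def lipNorm {M Y : Type*} [MetricSpace M] [NormedAddCommGroup Y]
    (F : M → Y) : ℝ :=
  sSup {r : ℝ | ∃ p q : M, p ≠ q ∧ r = ‖F p - F q‖ / dist p q}

/-- `F` strongly attains its norm. -/
def StronglyAttains {M Y : Type*} [MetricSpace M] [NormedAddCommGroup Y]
    (F : M → Y) : Prop :=
  ∃ p q : M, p ≠ q ∧ ‖F p - F q‖ = lipNorm F * dist p q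

/-- `F` is Lipschitz compact: its Lipschitz image is relatively compact. -/
def IsLipCompact {M Y : Type*} [MetricSpace M] [NormedAddCommGroup Y] [NormedSpace ℝ Y]
    (F : M → Y) : Prop :=
  IsCompact (closure {y : Y | ∃ p q : M, p ≠ q ∧ y = (dist p q)⁻¹ • (F p - F q)})

/-- The pair `(M,Y)` has the Lip-BPB property witnessed by the function `η`. -/
def LipBPBWith (M : Type*) [MetricSpace M] (z : M)
    (Y : Type*) [NormedAddCommGroup Y] (η : ℝ → ℝ) : Prop :=
  (∀ ε > 0, η ε > 0) ∧
  ∀ ε > 0, ∀ F : M → Y, IsLip0 z F → lipNorm F = 1 →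
    ∀ p q : M, p ≠ q → ‖F p - F q‖ > (1 - η ε) * dist p q →
      ∃ G : M → Y, IsLip0 z G ∧ ∃ r s : M, r ≠ s ∧
        ‖G r - G s‖ = dist r s ∧ lipNorm G = 1 ∧
        lipNorm (fun x => G x - F x) < ε ∧
        (dist p r + dist q s) / dist p q < ε

/-- The pair `(M,Y)` has the Lip-BPB property. -/
def LipBPB (M : Type*) [MetricSpace M] (z : M)
    (Y : Type*) [NormedAddCommGroup Y] : Prop :=
  ∃ η : ℝ → ℝ, LipBPBWith M z Y η

/-- The pair `(M,Y)` has the Lip-BPB property for Lipschitz compact maps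
witnessed by the function `η`. -/
def LipBPBCompactWith (M : Type*) [MetricSpace M] (z : M)
    (Y : Type*) [NormedAddCommGroup Y] [NormedSpace ℝ Y] (η : ℝ → ℝ) : Prop :=
  (∀ ε > 0, η ε > 0) ∧
  ∀ ε > 0, ∀ F : M → Y, IsLip0 z F → IsLipCompact F → lipNorm F = 1 →
    ∀ p q : M, p ≠ q → ‖F p - F q‖ > (1 - η ε) * dist p q →
      ∃ G : M → Y, IsLip0 z G ∧ IsLipCompact G ∧ ∃ r s : M, r ≠ s ∧
        ‖G r - G s‖ = dist r s ∧ lipNorm G = 1 ∧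
        lipNorm (fun x => G x - F x) < ε ∧
        (dist p r + dist q s) / dist p q < ε

/-- The pair `(M,Y)` has the Lip-BPB property for Lipschitz compact maps. -/
def LipBPBCompact (M : Type*) [MetricSpace M] (z : M)
    (Y : Type*) [NormedAddCommGroup Y] [NormedSpace ℝ Y] : Prop :=
  ∃ η : ℝ → ℝ, LipBPBCompactWith M z Y η

/-- `SA(M,Y)` is dense in `Lip₀(M,Y)`. -/
def SADense (M : Type*) [MetricSpace M] (z : M)
    (Y : Type*) [NormedAddCommGroup Y] : Prop :=
  ∀ F : M → Y, IsLip0 z F → ∀ ε > 0,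
    ∃ G : M → Y, IsLip0 z G ∧ StronglyAttains G ∧ lipNorm (fun x => G x - F x) < ε

/-- `SA_K(M,Y)` is dense in `Lipc(M,Y)`. -/
def SAKDense (M : Type*) [MetricSpace M] (z : M)
    (Y : Type*) [NormedAddCommGroup Y] [NormedSpace ℝ Y] : Prop :=
  ∀ F : M → Y, IsLip0 z F → IsLipCompact F → ∀ ε > 0,
    ∃ G : M → Y, IsLip0 z G ∧ IsLipCompact G ∧ StronglyAttains G ∧
      lipNorm (fun x => G x - F x) < ε

section Aux

lemma lipNorm_le_aux {M Y : Type*} [MetricSpace M] [NormedAddCommGroup Y] {F : M → Y} {C : ℝ}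
    (hC : 0 ≤ C) (h : ∀ p q, p ≠ q → ‖F p - F q‖ / dist p q ≤ C) : lipNorm F ≤ C := by
  apply Real.sSup_le _ hC
  rintro r ⟨p, q, hpq, rfl⟩
  exact h p q hpq

lemma le_lipNorm_aux {M Y : Type*} [MetricSpace M] [NormedAddCommGroup Y] {F : M → Y} {K : ℝ≥0}
    (h : LipschitzWith K F) {p q : M} (hpq : p ≠ q) : ‖F p - F q‖ / dist p q ≤ lipNorm F := by
  apply le_csSup
  · refine ⟨K, ?_⟩
    rintro r ⟨p, q, hpq, rfl⟩
    rw [div_le_iff₀ (dist_pos.2 hpq), ← dist_eq_norm]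
    exact h.dist_le_mul p q
  · exact ⟨p, q, hpq, rfl⟩

lemma norm_slope_aux {M Y : Type*} [MetricSpace M] [NormedAddCommGroup Y] [NormedSpace ℝ Y]
    (F : M → Y) (p q : M) : ‖(dist p q)⁻¹ • (F p - F q)‖ = ‖F p - F q‖ / dist p q := by
  rw [norm_smul, norm_inv, Real.norm_of_nonneg dist_nonneg]; ring

variable {Y : Type*} [NormedAddCommGroup Y] [NormedSpace ℝ Y]
  {α : Type*} [MeasurableSpace α] {μ : Measure α}

lemma linf_ae_le (f : Lp Y ⊤ μ) : ∀ᵐ t ∂μ, ‖f t‖ ≤ ‖f‖ := by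
  have h := enorm_ae_le_eLpNormEssSup f μ
  have h2 := Lp.eLpNorm_ne_top f
  rw [Lp.norm_def]
  filter_upwards [h] with t ht
  rw [← eLpNorm_exponent_top] at ht
  have := ENNReal.toReal_mono h2 ht
  simpa using this

lemma linf_norm_le (f : Lp Y ⊤ μ) {C : ℝ} (hC : 0 ≤ C) (h : ∀ᵐ t ∂μ, ‖f t‖ ≤ C) : ‖f‖ ≤ C := by
  rw [Lp.norm_def, eLpNorm_exponent_top]
  apply ENNReal.toReal_le_of_le_ofReal hC
  exact eLpNormEssSup_le_of_ae_bound h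

lemma exists_small_osc (f : Lp Y ⊤ μ) {A : Set α} (hA : MeasurableSet A) (h0 : μ A ≠ 0)
    {δ : ℝ} (hδ : 0 < δ) :
    ∃ B ⊆ A, MeasurableSet B ∧ μ B ≠ 0 ∧ ∃ y : Y, ∀ t ∈ B, ‖f t - y‖ ≤ δ := by
  have hf := Lp.stronglyMeasurable f
  obtain ⟨c, hc, hcl⟩ := hf.isSeparable_range
  by_contra! hcon
  apply h0
  have hcov : A ⊆ ⋃ y ∈ c, (A ∩ {t | ‖f t - y‖ ≤ δ}) := by
    intro t ht
    have h1 := hcl (mem_range_self t)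
    obtain ⟨y, hy, hd⟩ := Metric.mem_closure_iff.1 h1 δ hδ
    simp only [mem_iUnion]
    refine ⟨y, hy, ht, ?_⟩
    rw [dist_eq_norm] at hd
    exact hd.le
  refine measure_mono_null hcov ((measure_biUnion_null_iff hc).2 ?_)
  intro y hy
  by_contra hne
  have hm : MeasurableSet (A ∩ {t | ‖f t - y‖ ≤ δ}) :=
    hA.inter ((hf.sub stronglyMeasurable_const).norm.measurable measurableSet_Iic)
  obtain ⟨t, ht, h2⟩ := hcon _ inter_subset_left hm hne y
  exact absurd ht.2 (not_le.2 h2)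

lemma exists_small_osc_finset {s : Set (Lp Y ⊤ μ)} (hs : s.Finite) {A : Set α}
    (hA : MeasurableSet A) (h0 : μ A ≠ 0) {δ : ℝ} (hδ : 0 < δ) :
    ∃ B ⊆ A, MeasurableSet B ∧ μ B ≠ 0 ∧ ∀ f ∈ s, ∃ y : Y, ∀ t ∈ B, ‖f t - y‖ ≤ δ := by
  induction s, hs using Set.Finite.induction_on with
  | empty => exact ⟨A, Subset.rfl, hA, h0, by simp⟩
  | @insert f s _ _ ih =>
    obtain ⟨B, hB, hBm, hB0, h⟩ := ih
    obtain ⟨C, hC, hCm, hC0, y, hy⟩ := exists_small_osc f hBm hB0 hδ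
    refine ⟨C, hC.trans hB, hCm, hC0, ?_⟩
    rintro g (rfl | hg)
    · exact ⟨y, hy⟩
    · obtain ⟨w, hw⟩ := h g hg
      exact ⟨w, fun t ht => hw t (hC ht)⟩

lemma exists_avg [CompleteSpace Y] {B : Set α} (h0 : μ B ≠ 0) (ht : μ B ≠ ⊤) :
    ∃ T : Lp Y ⊤ μ →L[ℝ] Y, (∀ f (y : Y) (r : ℝ), (∀ᵐ t ∂μ.restrict B, ‖f t - y‖ ≤ r) →
      ‖T f - y‖ ≤ r) ∧ ∀ f, ‖T f‖ ≤ ‖f‖ := by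
  have : IsFiniteMeasure (μ.restrict B) := ⟨by simpa using ht.lt_top⟩
  have hi : ∀ f : Lp Y ⊤ μ, IntegrableOn f B μ := fun f =>
    MemLp.integrable le_top ((Lp.memLp f).restrict B)
  have hb : ∀ (f : Lp Y ⊤ μ) (y : Y) (r : ℝ), (∀ᵐ t ∂μ.restrict B, ‖f t - y‖ ≤ r) →
      ‖(⨍ t in B, f t ∂μ) - y‖ ≤ r := by
    intro f y r h
    have := (convex_closedBall y r).set_average_mem isClosed_closedBall h0 ht
      (f := f) (by simpa [dist_eq_norm] using h) (hi f)
    simpa [dist_eq_norm] using this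
  have hb0 : ∀ f : Lp Y ⊤ μ, ‖⨍ t in B, f t ∂μ‖ ≤ ‖f‖ := by
    intro f
    have := hb f 0 ‖f‖ (by simpa using ae_restrict_of_ae (linf_ae_le f))
    simpa using this
  let T : Lp Y ⊤ μ →ₗ[ℝ] Y :=
    { toFun := fun f => ⨍ t in B, f t ∂μ
      map_add' := by
        intro f g
        simp only [setAverage_eq]
        rw [integral_congr_ae (ae_restrict_of_ae (Lp.coeFn_add f g))]
        simp only [Pi.add_apply]
        rw [integral_add (hi f) (hi g), smul_add]
      map_smul' := by
        intro c f
        simp only [setAverage_eq]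
        rw [integral_congr_ae (ae_restrict_of_ae (Lp.coeFn_smul c f))]
        simp only [Pi.smul_apply, RingHom.id_apply]
        rw [integral_smul, smul_comm] }
  refine ⟨T.mkContinuous 1 (by simpa [T] using hb0), ?_, ?_⟩
  · exact hb
  · exact hb0

lemma exists_glue {B : Set α} (hB : MeasurableSet B) :
    ∃ P : (Lp Y ⊤ μ × Y) →L[ℝ] Lp Y ⊤ μ, ∀ f y, (∀ᵐ t ∂μ, t ∈ B → P (f, y) t = y) ∧
      (∀ᵐ t ∂μ, t ∉ B → P (f, y) t = f t) := by
  classical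
  have hm : ∀ x : Lp Y ⊤ μ × Y, MemLp (B.piecewise (fun _ => x.2) x.1) ⊤ μ := fun x =>
    MemLp.piecewise hB ((memLp_top_const x.2).restrict B) ((Lp.memLp x.1).restrict _)
  have hae : ∀ x : Lp Y ⊤ μ × Y, (hm x).toLp _ =ᵐ[μ] B.piecewise (fun _ => x.2) x.1 :=
    fun x => (hm x).coeFn_toLp
  let P : (Lp Y ⊤ μ × Y) →ₗ[ℝ] Lp Y ⊤ μ :=
    { toFun := fun x => (hm x).toLp _
      map_add' := by
        intro x y
        apply Lp.ext
        filter_upwards [hae x, hae y, hae (x + y), Lp.coeFn_add ((hm x).toLp _) ((hm y).toLp _),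
          Lp.coeFn_add x.1 y.1] with t h1 h2 h3 h4 h5
        rw [h3, h4, Pi.add_apply, h1, h2]
        by_cases ht : t ∈ B
        · simp [ht]
        · simpa [ht] using h5
      map_smul' := by
        intro c x
        apply Lp.ext
        filter_upwards [hae x, hae (c • x), Lp.coeFn_smul c ((hm x).toLp _),
          Lp.coeFn_smul c x.1] with t h1 h3 h4 h5
        rw [h3, RingHom.id_apply, h4, Pi.smul_apply, h1]
        by_cases ht : t ∈ B <;> simp [ht, h5] }
  refine ⟨P.mkContinuous 1 ?_, ?_⟩
  · intro x
    rw [one_mul]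
    apply linf_norm_le _ (norm_nonneg _)
    filter_upwards [hae x, linf_ae_le x.1] with t h1 h2
    change ‖((hm x).toLp _ : Lp Y ⊤ μ) t‖ ≤ _
    rw [h1]
    by_cases ht : t ∈ B
    · simpa [ht] using norm_snd_le x
    · simpa [ht] using h2.trans (norm_fst_le x)
  · intro f y
    constructor
    · filter_upwards [hae (f, y)] with t h1 ht
      change ((hm (f, y)).toLp _ : Lp Y ⊤ μ) t = _
      rw [h1]; simp [ht]
    · filter_upwards [hae (f, y)] with t h1 ht
      change ((hm (f, y)).toLp _ : Lp Y ⊤ μ) t = _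
      rw [h1]; simp [ht]

end Aux

lemma isLipCompact_aux {M Z : Type*} [MetricSpace M] [NormedAddCommGroup Z] [NormedSpace ℝ Z]
    (H : M → Z) (L : Set Z) (hL : IsCompact L)
    (hH : ∀ x y, x ≠ y → (dist x y)⁻¹ • (H x - H y) ∈ L) : IsLipCompact H := by
  apply hL.closure_of_subset
  rintro z ⟨x, y, hxy, rfl⟩
  exact hH x y hxy

/-- If `(M, Y)` has the Lip-BPB property for Lipschitz compact maps, then for every σ-finite
positive measure `μ`, `(M, L∞(μ, Y))` has the Lip-BPB property for Lipschitz compact maps. -/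
theorem lipBPBCompact_Linfty {M Y : Type*} [MetricSpace M] [CompleteSpace M]
    [NormedAddCommGroup Y] [NormedSpace ℝ Y] [CompleteSpace Y]
    (z : M) (h : LipBPBCompact M z Y)
    {α : Type*} [MeasurableSpace α] (μ : Measure α) [SigmaFinite μ] :
    LipBPBCompact M z (Lp Y ⊤ μ) := by
  obtain ⟨η, hη, h⟩ := h
  refine ⟨fun ε => min (min (1/2) (ε / 16)) (η (ε / 2) / 4), ?_, ?_⟩
  · intro ε hε
    have := hη (ε / 2) (by positivity)
    simp only [gt_iff_lt, lt_min_iff]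
    refine ⟨⟨by norm_num, by positivity⟩, by positivity⟩
  intro ε hε F hF hFc hF1 p q hpq hFpq
  have hε2 : 0 < ε / 2 := by positivity
  have hη2 := hη (ε / 2) hε2
  obtain ⟨e, he⟩ : ∃ e, e = min (min (1/2) (ε / 16)) (η (ε / 2) / 4) := ⟨_, rfl⟩
  have he0 : 0 < e := by
    rw [he]; simp only [lt_min_iff]
    refine ⟨⟨by norm_num, by positivity⟩, by positivity⟩
  have he1 : e ≤ 1 / 2 := by rw [he]; exact (min_le_left _ _).trans (min_le_left _ _)
  have he2 : e ≤ ε / 16 := by rw [he]; exact (min_le_left _ _).trans (min_le_right _ _)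
  have he3 : e ≤ η (ε / 2) / 4 := by rw [he]; exact min_le_right _ _
  simp only [← he] at hFpq
  clear he
  obtain ⟨⟨KF, hKF⟩, hFz⟩ := hF
  have hd : 0 < dist p q := dist_pos.2 hpq
  have hsl1 : ∀ x y, x ≠ y → ‖(dist x y)⁻¹ • (F x - F y)‖ ≤ 1 := by
    intro x y hxy
    rw [norm_slope_aux, ← hF1]
    exact le_lipNorm_aux hKF hxy
  set K := closure {y : Lp Y ⊤ μ | ∃ p q : M, p ≠ q ∧ y = (dist p q)⁻¹ • (F p - F q)} with hK
  have hKc : IsCompact K := hFc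
  have hKm : ∀ x y, x ≠ y → (dist x y)⁻¹ • (F x - F y) ∈ K :=
    fun x y hxy => subset_closure ⟨x, y, hxy, rfl⟩
  set f₀ := (dist p q)⁻¹ • (F p - F q) with hf₀
  have hf₀n : 1 - e < ‖f₀‖ := by
    rw [hf₀, norm_slope_aux, lt_div_iff₀ hd]; exact hFpq
  -- the large set
  obtain ⟨A, hA, hA0, hAt, hAf⟩ : ∃ A : Set α, MeasurableSet A ∧ μ A ≠ 0 ∧ μ A ≠ ⊤ ∧
      ∀ t ∈ A, 1 - e < ‖f₀ t‖ := by
    have hm : MeasurableSet {t | 1 - e < ‖f₀ t‖} :=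
      (Lp.stronglyMeasurable f₀).norm.measurable measurableSet_Ioi
    have h0 : 0 < μ {t | 1 - e < ‖f₀ t‖} := by
      rw [pos_iff_ne_zero]
      intro h0
      apply absurd hf₀n
      rw [not_lt]
      apply linf_norm_le _ (by linarith)
      rw [ae_iff]
      simpa only [not_le] using h0
    obtain ⟨A, hA, hAs, hA0, hAt⟩ := Measure.exists_subset_measure_lt_top hm h0
    exact ⟨A, hA, hA0.ne', hAt.ne, fun t ht => hAs ht⟩
  obtain ⟨s, -, hsf, hs⟩ := hKc.finite_cover_balls (e := e / 8) (by positivity)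
  obtain ⟨B, hBA, hB, hB0, hBf⟩ := exists_small_osc_finset (hsf.insert f₀) hA hA0
    (δ := e / 8) (by positivity)
  have hBt : μ B ≠ ⊤ := (measure_mono hBA).trans_lt hAt.lt_top |>.ne
  obtain ⟨T, hT, hTn⟩ := exists_avg (Y := Y) hB0 hBt
  obtain ⟨P, hP⟩ := exists_glue (Y := Y) (μ := μ) hB
  -- `T k` is close to `k` on `B`
  have hclose : ∀ k ∈ K, ∀ᵐ t ∂μ, t ∈ B → ‖k t - T k‖ ≤ e / 2 := by
    intro k hk
    obtain ⟨f, hf, hkf⟩ := mem_iUnion₂.1 (hs hk)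
    obtain ⟨y, hy⟩ := hBf f (mem_insert_of_mem _ hf)
    rw [mem_ball, dist_eq_norm] at hkf
    have h1 : ∀ᵐ t ∂μ, t ∈ B → ‖k t - y‖ ≤ e / 4 := by
      filter_upwards [linf_ae_le (k - f), Lp.coeFn_sub k f] with t h1 h2 ht
      rw [h2, Pi.sub_apply] at h1
      have h3 := hy t ht
      have h4 := norm_sub_le_norm_sub_add_norm_sub (k t) (f t) y
      linarith
    have h2 : ‖T k - y‖ ≤ e / 4 := hT k y _ ((ae_restrict_iff' hB).2 h1)
    filter_upwards [h1] with t h1 ht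
    have h3 := h1 ht
    have h4 := norm_sub_le_norm_sub_add_norm_sub (k t) y (T k)
    rw [norm_sub_rev y] at h4
    linarith
  have hTf₀ : 1 - 2 * e < ‖T f₀‖ := by
    have h1 := hclose f₀ (hKm p q hpq)
    obtain ⟨t, htB, ht⟩ : ∃ t ∈ B, ‖f₀ t - T f₀‖ ≤ e / 2 := by
      by_contra! hcon
      apply hB0
      refine measure_mono_null ?_ (ae_iff.1 h1)
      intro t ht
      simp only [mem_setOf_eq, Classical.not_imp, not_le]
      exact ⟨ht, hcon t ht⟩
    have h2 := hAf t (hBA htB)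
    have h3 := norm_sub_norm_le (f₀ t) (T f₀)
    linarith
  -- the scalar-free map
  have hslT : ∀ x y, (dist x y)⁻¹ • (T (F x) - T (F y)) = T ((dist x y)⁻¹ • (F x - F y)) := by
    intro x y; rw [map_smul, map_sub]
  have hF0L : LipschitzWith (‖T‖₊ * KF) (fun x => T (F x)) := T.lipschitz.comp hKF
  obtain ⟨c, hc⟩ : ∃ c, c = lipNorm (fun x => T (F x)) := ⟨_, rfl⟩
  have hc1 : c ≤ 1 := by
    rw [hc]
    apply lipNorm_le_aux zero_le_one
    intro x y hxy
    rw [← norm_slope_aux (fun x => T (F x)), hslT]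
    exact (hTn _).trans (hsl1 x y hxy)
  have hcle : ∀ x y, x ≠ y → ‖T ((dist x y)⁻¹ • (F x - F y))‖ ≤ c := by
    intro x y hxy
    rw [hc, ← hslT, norm_slope_aux (fun x => T (F x))]
    exact le_lipNorm_aux hF0L hxy
  have hc2 : 1 - 2 * e < c := hTf₀.trans_le (hcle p q hpq)
  have hc0 : 0 < c := by linarith
  let F₁ : M → Y := fun x => c⁻¹ • T (F x)
  have hslF₁ : ∀ x y, (dist x y)⁻¹ • (F₁ x - F₁ y) = c⁻¹ • T ((dist x y)⁻¹ • (F x - F y)) := by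
    intro x y
    simp only [F₁]
    rw [← smul_sub, smul_comm, hslT]
  have hF₁L : LipschitzWith (‖c⁻¹‖₊ * (‖T‖₊ * KF)) F₁ := (lipschitzWith_smul c⁻¹).comp hF0L
  have hF₁n : lipNorm F₁ = 1 := by
    apply le_antisymm
    · apply lipNorm_le_aux zero_le_one
      intro x y hxy
      rw [← norm_slope_aux, hslF₁, norm_smul, norm_inv, Real.norm_of_nonneg hc0.le,
        inv_mul_le_iff₀ hc0, mul_one]
      exact hcle x y hxy
    · have h1 : c ≤ c * lipNorm F₁ := by
        conv_lhs => rw [hc]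
        have h0 : 0 ≤ lipNorm F₁ :=
          le_trans (by positivity) (le_lipNorm_aux hF₁L hpq)
        apply lipNorm_le_aux (by positivity)
        intro x y hxy
        have h2 := le_lipNorm_aux hF₁L hxy
        rw [← norm_slope_aux, hslF₁, norm_smul, norm_inv, Real.norm_of_nonneg hc0.le,
          inv_mul_le_iff₀ hc0] at h2
        rwa [← norm_slope_aux (fun x => T (F x)), hslT]
      nlinarith
  have hF₁c : IsLipCompact F₁ := by
    apply isLipCompact_aux F₁ _ (hKc.image (f := fun k => c⁻¹ • T k) (by fun_prop))
    intro x y hxy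
    exact ⟨_, hKm x y hxy, (hslF₁ x y).symm⟩
  obtain ⟨G₀, ⟨⟨KG, hKG⟩, hG₀z⟩, hG₀c, r, s', hrs, hG₀rs, hG₀n, hG₀F, hclose2⟩ :=
    h (ε / 2) hε2 F₁ ⟨⟨_, hF₁L⟩, by simp [F₁, hFz]⟩ hF₁c hF₁n p q hpq (by
      have h1 : 1 - η (ε / 2) < ‖F₁ p - F₁ q‖ / dist p q := by
        rw [← norm_slope_aux, hslF₁, norm_smul, norm_inv, Real.norm_of_nonneg hc0.le]
        rw [← hf₀]
        have h2 : 1 ≤ c⁻¹ := (one_le_inv₀ hc0).2 hc1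
        have h3 : ‖T f₀‖ ≤ c⁻¹ * ‖T f₀‖ := le_mul_of_one_le_left (norm_nonneg _) h2
        linarith
      exact (lt_div_iff₀ hd).1 h1)
  let G : M → Lp Y ⊤ μ := fun x => P (F x, G₀ x)
  have hslG : ∀ x y, (dist x y)⁻¹ • (G x - G y) =
      P ((dist x y)⁻¹ • (F x - F y), (dist x y)⁻¹ • (G₀ x - G₀ y)) := by
    intro x y
    simp only [G]
    rw [← map_sub, ← map_smul]
    rfl
  have hGL : LipschitzWith (‖P‖₊ * max KF KG) G := P.lipschitz.comp (hKF.prodMk hKG)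
  have hG₀sl : ∀ x y, x ≠ y → ‖(dist x y)⁻¹ • (G₀ x - G₀ y)‖ ≤ 1 := by
    intro x y hxy
    rw [norm_slope_aux, ← hG₀n]
    exact le_lipNorm_aux hKG hxy
  have hGsl : ∀ x y, x ≠ y → ‖(dist x y)⁻¹ • (G x - G y)‖ ≤ 1 := by
    intro x y hxy
    rw [hslG]
    obtain ⟨h1, h2⟩ := hP ((dist x y)⁻¹ • (F x - F y)) ((dist x y)⁻¹ • (G₀ x - G₀ y))
    apply linf_norm_le _ zero_le_one
    filter_upwards [h1, h2, linf_ae_le ((dist x y)⁻¹ • (F x - F y))] with t h1 h2 h3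
    by_cases ht : t ∈ B
    · rw [h1 ht]; exact hG₀sl x y hxy
    · rw [h2 ht]; exact h3.trans (hsl1 x y hxy)
  have hdrs : 0 < dist r s' := dist_pos.2 hrs
  have hGrs1 : 1 ≤ ‖(dist r s')⁻¹ • (G r - G s')‖ := by
    rw [hslG]
    obtain ⟨h1, -⟩ := hP ((dist r s')⁻¹ • (F r - F s')) ((dist r s')⁻¹ • (G₀ r - G₀ s'))
    set g := P ((dist r s')⁻¹ • (F r - F s'), (dist r s')⁻¹ • (G₀ r - G₀ s'))
    by_contra! hlt
    apply hB0
    have h3 : ∀ᵐ t ∂μ, t ∉ B := by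
      filter_upwards [h1, linf_ae_le g] with t h1 h2 ht
      rw [h1 ht, norm_slope_aux, hG₀rs, div_self hdrs.ne'] at h2
      linarith
    simpa [ae_iff] using h3
  have hGrs : ‖G r - G s'‖ = dist r s' := by
    have h1 := le_antisymm (hGsl r s' hrs) hGrs1
    rwa [norm_slope_aux, div_eq_one_iff_eq hdrs.ne'] at h1
  have hDL : LipschitzWith (KG + ‖c⁻¹‖₊ * (‖T‖₊ * KF)) (fun x => G₀ x - F₁ x) := hKG.sub hF₁L
  refine ⟨G, ⟨⟨_, hGL⟩, by simp only [G, hFz, hG₀z]; exact map_zero P⟩, ?_, r, s', hrs, hGrs, ?_, ?_,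
    by linarith⟩
  · apply isLipCompact_aux G _ ((hKc.prod hG₀c).image P.continuous)
    intro x y hxy
    exact ⟨(_, _), ⟨hKm x y hxy, subset_closure ⟨x, y, hxy, rfl⟩⟩, (hslG x y).symm⟩
  · apply le_antisymm
    · apply lipNorm_le_aux zero_le_one
      intro x y hxy
      rw [← norm_slope_aux]
      exact hGsl x y hxy
    · have := le_lipNorm_aux hGL hrs
      rwa [hGrs, div_self hdrs.ne'] at this
  · refine lt_of_le_of_lt (b := lipNorm (fun x => G₀ x - F₁ x) + 2 * e + e / 2) ?_ (by linarith)
    have hL0 : 0 ≤ lipNorm (fun x => G₀ x - F₁ x) :=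
      le_trans (by positivity) (le_lipNorm_aux hDL hpq)
    apply lipNorm_le_aux (by positivity)
    intro x y hxy
    have hD := le_lipNorm_aux hDL hxy
    rw [← norm_slope_aux (fun x => G₀ x - F₁ x)] at hD
    rw [← norm_slope_aux (fun x => G x - F x)]
    have e1 : (dist x y)⁻¹ • (G x - F x - (G y - F y)) =
        (dist x y)⁻¹ • (G x - G y) - (dist x y)⁻¹ • (F x - F y) := by
      rw [← smul_sub]; congr 1; abel
    have e2 : (dist x y)⁻¹ • (G₀ x - F₁ x - (G₀ y - F₁ y)) =
        (dist x y)⁻¹ • (G₀ x - G₀ y) - c⁻¹ • T ((dist x y)⁻¹ • (F x - F y)) := by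
      rw [← hslF₁, ← smul_sub]; congr 1; abel
    rw [e1, hslG]
    rw [e2] at hD
    have hk := hKm x y hxy
    have hck := hcle x y hxy
    set k := (dist x y)⁻¹ • (F x - F y)
    set g := (dist x y)⁻¹ • (G₀ x - G₀ y)
    have hsc : ‖c⁻¹ • T k - T k‖ ≤ 2 * e := by
      have e3 : c⁻¹ • T k - T k = (c⁻¹ - 1) • T k := by rw [sub_smul, one_smul]
      have h2 : 0 ≤ c⁻¹ - 1 := sub_nonneg.2 ((one_le_inv₀ hc0).2 hc1)
      rw [e3, norm_smul, Real.norm_of_nonneg h2]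
      calc (c⁻¹ - 1) * ‖T k‖ ≤ (c⁻¹ - 1) * c := by gcongr
        _ = 1 - c := by field_simp
        _ ≤ 2 * e := by linarith
    obtain ⟨h1, h2⟩ := hP k g
    apply linf_norm_le _ (by positivity)
    filter_upwards [h1, h2, hclose k hk, Lp.coeFn_sub (P (k, g)) k] with t h1 h2 h3 h4
    rw [h4, Pi.sub_apply]
    by_cases ht : t ∈ B
    · rw [h1 ht]
      have h5 := norm_sub_le_norm_sub_add_norm_sub g (c⁻¹ • T k) (k t)
      have h6 := norm_sub_le_norm_sub_add_norm_sub (c⁻¹ • T k) (T k) (k t)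
      have h7 := h3 ht
      rw [norm_sub_rev] at h7
      linarith
    · rw [h2 ht, sub_self, norm_zero]; positivity
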